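/- arXiv:2102.09396 — 6 statements merged into one kernel-verified Lean document; each statement's English description precedes it below -/
import Mathlib

section
/- Let m, n ≥ 1 be integers, let Q ∈ ℝ^{m×m} be a diagonal matrix with positive diagonal entries, let A_0 ≥ A_1 ≥ ⋯ ≥ A_{n−1} > 0 be real numbers (with the convention A_1 := 0 when n = 1), and let θ ∈ [0,1) satisfy A_1 < A_0 and θ/(A_0 − A_1) ≤ (1−θ)/A_0. Then for any vectors z^0, …, z^n ∈ ℝ^m, writing z^{n−θ} := (1−θ)z^n + θz^{n−1} and w := ∑_{k=1}^n A_{n−k}(z^k − z^{k−1}), one has (z^{n−θ})ᵀ Q w ≥ (1/2) ∑_{k=1}^n A_{n−k} [ (z^k)ᵀQz^k − (z^{k−1})ᵀQz^{k−1} ]. -/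
open Finset

/-- Jensen's inequality for weighted increments, after summation by parts. -/
theorem sq_sum_mul_sub_add_le (c u : ℕ → ℝ) (N : ℕ) (hpos : ∀ j ≤ N, 0 < c j)
    (hmono : ∀ j < N, c j ≤ c (j + 1)) :
    (∑ j ∈ range (N + 1), c j * (u j - u (j + 1)) + c N * u (N + 1)) ^ 2 ≤
      c N * (∑ j ∈ range (N + 1), c j * (u j ^ 2 - u (j + 1) ^ 2) + c N * u (N + 1) ^ 2) := by
  induction N with
  | zero => simp only [zero_add, sum_range_one]; apply le_of_eq; ring
  | succ N ih =>
    have ih' := ih (fun j hj => hpos j (by omega)) (fun j hj => hmono j (by omega))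
    have hc := hpos N (by omega)
    have he := hmono N (by omega)
    rw [sum_range_succ _ (N + 1), sum_range_succ _ (N + 1)]
    set w := ∑ j ∈ range (N + 1), c j * (u j - u (j + 1))
    set T := ∑ j ∈ range (N + 1), c j * (u j ^ 2 - u (j + 1) ^ 2)
    obtain ⟨e, he'⟩ : ∃ e, c (N + 1) = c N + e := ⟨c (N + 1) - c N, by ring⟩
    have he0 : 0 ≤ e := by linarith
    rw [he']
    generalize c N = b at *
    generalize u (N + 1) = x at *
    obtain ⟨W, hW⟩ : ∃ W, W = w + b * x := ⟨_, rfl⟩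
    obtain ⟨V, hV⟩ : ∃ V, V = T + b * x ^ 2 := ⟨_, rfl⟩
    rw [← hW, ← hV] at ih'
    have key : 0 ≤ V + b * x ^ 2 - 2 * W * x := by
      refine nonneg_of_mul_nonneg_right (a := b) ?_ hc
      nlinarith [sq_nonneg (W - b * x)]
    have hw : w = W - b * x := by linarith
    have hT : T = V - b * x ^ 2 := by linarith
    rw [hw, hT]
    nlinarith [mul_nonneg he0 key]

theorem sum_mul_sub_sq_eq (c v : ℕ → ℝ) (x : ℝ) (N : ℕ) :
    ∑ j ∈ range N, c j * ((x - v j) ^ 2 - (x - v (j + 1)) ^ 2) =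
      2 * x * ∑ j ∈ range N, c j * (v (j + 1) - v j) -
        ∑ j ∈ range N, c j * (v (j + 1) * v (j + 1) - v j * v j) := by
  rw [mul_sum, ← sum_sub_distrib]
  exact sum_congr rfl fun j _ => by ring

theorem sum_mul_sub_sub_eq (c v : ℕ → ℝ) (x : ℝ) (N : ℕ) :
    ∑ j ∈ range N, c j * ((x - v j) - (x - v (j + 1))) =
      ∑ j ∈ range N, c j * (v (j + 1) - v j) :=
  sum_congr rfl fun j _ => by ring

/-- The lower bound obtained by testing with the final value. -/
theorem sq_sum_le_test_final (c v : ℕ → ℝ) (N : ℕ) (hpos : ∀ j ≤ N, 0 < c j)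
    (hmono : ∀ j < N, c j ≤ c (j + 1)) :
    (∑ j ∈ range (N + 1), c j * (v (j + 1) - v j)) ^ 2 ≤
      c N * (2 * v (N + 1) * ∑ j ∈ range (N + 1), c j * (v (j + 1) - v j) -
        ∑ j ∈ range (N + 1), c j * (v (j + 1) * v (j + 1) - v j * v j)) := by
  have h := sq_sum_mul_sub_add_le c (fun j => v (N + 1) - v j) N hpos hmono
  simp only [sum_mul_sub_sq_eq, sum_mul_sub_sub_eq] at h
  simpa using h

/-- The lower bound obtained by testing with the penultimate value. -/
theorem neg_sq_sum_le_test_penultimate (c v : ℕ → ℝ) (N : ℕ) (b : ℝ)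
    (hb : b = if N = 0 then 0 else c (N - 1)) (hbc : b < c N) (hpos : ∀ j ≤ N, 0 < c j)
    (hmono : ∀ j < N, c j ≤ c (j + 1)) :
    -(∑ j ∈ range (N + 1), c j * (v (j + 1) - v j)) ^ 2 ≤
      (c N - b) * (2 * v N * ∑ j ∈ range (N + 1), c j * (v (j + 1) - v j) -
        ∑ j ∈ range (N + 1), c j * (v (j + 1) * v (j + 1) - v j * v j)) := by
  cases N with
  | zero =>
    simp only [if_true] at hb
    subst hb
    simp only [zero_add, sum_range_one]
    apply le_of_eq; ring
  | succ M =>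
    simp only [Nat.add_eq_zero_iff, one_ne_zero, and_false, if_false, Nat.add_sub_cancel] at hb
    have h := sq_sum_le_test_final c v M (fun j hj => hpos j (by omega))
      (fun j hj => hmono j (by omega))
    rw [← hb] at h
    have hb0 : 0 < b := hb ▸ hpos M (by omega)
    rw [sum_range_succ _ (M + 1), sum_range_succ _ (M + 1)]
    set w := ∑ j ∈ range (M + 1), c j * (v (j + 1) - v j)
    set S := ∑ j ∈ range (M + 1), c j * (v (j + 1) * v (j + 1) - v j * v j)
    generalize c (M + 1) = a at *
    generalize v (M + 1) = x at *
    obtain ⟨d, hd⟩ : ∃ d, v (M + 1 + 1) = x + d := ⟨v (M + 1 + 1) - x, by ring⟩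
    rw [hd]
    obtain ⟨T, hT⟩ : ∃ T, T = 2 * x * w - S := ⟨_, rfl⟩
    rw [← hT] at h
    have hS : S = 2 * x * w - T := by linarith
    rw [hS]
    have key : 0 ≤ b * ((a - b) * (T - a * d ^ 2) + (w + a * d) ^ 2) := by
      have h1 := mul_le_mul_of_nonneg_left h (sub_pos.2 hbc).le
      have ha : 0 < a := hb0.trans hbc
      nlinarith [mul_nonneg ha.le (sq_nonneg (w + b * d))]
    have := nonneg_of_mul_nonneg_right key hb0
    nlinarith

/-- The scalar Alikhanov-type quadratic inequality. -/
theorem half_sum_sq_sub_le_interpolated (c v : ℕ → ℝ) (N : ℕ) (b θ : ℝ)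
    (hb : b = if N = 0 then 0 else c (N - 1)) (hbc : b < c N) (hpos : ∀ j ≤ N, 0 < c j)
    (hmono : ∀ j < N, c j ≤ c (j + 1)) (hθ0 : 0 ≤ θ) (hθ1 : θ < 1)
    (hθ : θ / (c N - b) ≤ (1 - θ) / c N) :
    (1 / 2) * ∑ j ∈ range (N + 1), c j * (v (j + 1) * v (j + 1) - v j * v j) ≤
      ((1 - θ) * v (N + 1) + θ * v N) * ∑ j ∈ range (N + 1), c j * (v (j + 1) - v j) := by
  have hX := sq_sum_le_test_final c v N hpos hmono
  have hY := neg_sq_sum_le_test_penultimate c v N b hb hbc hpos hmono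
  have ha := hpos N le_rfl
  have hab := sub_pos.2 hbc
  set w := ∑ j ∈ range (N + 1), c j * (v (j + 1) - v j)
  set S := ∑ j ∈ range (N + 1), c j * (v (j + 1) * v (j + 1) - v j * v j)
  rw [mul_comm (c N), ← div_le_iff₀ ha] at hX
  rw [mul_comm (c N - b), ← div_le_iff₀ hab] at hY
  have h1 := mul_le_mul_of_nonneg_left hX (sub_pos.2 hθ1).le
  have h2 := mul_le_mul_of_nonneg_left hY hθ0
  have h3 := mul_le_mul_of_nonneg_right hθ (sq_nonneg w)
  have e1 : (1 - θ) * (w ^ 2 / c N) = (1 - θ) / c N * w ^ 2 := by ring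
  have e2 : θ * (-w ^ 2 / (c N - b)) = -(θ / (c N - b) * w ^ 2) := by ring
  linarith

/-- Lemma 2.1, inequality (2.1) of the paper.
For a diagonal matrix `Q` with positive diagonal entries `q i`, non-increasing positive
kernels `A 0 ≥ A 1 ≥ ⋯ ≥ A (n-1) > 0` (with the convention `A 1 := 0` when `n = 1`), and
`θ ∈ [0,1)` with `θ/(A 0 − A 1) ≤ (1−θ)/A 0`, the weighted Alikhanov quadratic inequality
`(z^{n−θ})ᵀ Q w ≥ (1/2) ∑_{k=1}^n A_{n−k} [(z^k)ᵀQz^k − (z^{k−1})ᵀQz^{k−1}]` holds, where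
`w = ∑_{k=1}^n A_{n−k} (z^k − z^{k−1})`. -/
theorem stmt0 (m n : ℕ) (hm : 1 ≤ m) (hn : 1 ≤ n)
    (q : Fin m → ℝ) (hq : ∀ i, 0 < q i)
    (A : ℕ → ℝ)
    (hApos : ∀ k, k < n → 0 < A k)
    (hAmono : ∀ k, k + 1 < n → A (k + 1) ≤ A k)
    (θ : ℝ) (hθ0 : 0 ≤ θ) (hθ1 : θ < 1)
    (A1 : ℝ) (hA1 : A1 = if n = 1 then 0 else A 1)
    (hA1lt : A1 < A 0)
    (hθA : θ / (A 0 - A1) ≤ (1 - θ) / A 0)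
    (z : ℕ → Fin m → ℝ) :
    (1 / 2) * ∑ k ∈ Icc 1 n, A (n - k) *
        ((∑ i, q i * z k i * z k i) - ∑ i, q i * z (k - 1) i * z (k - 1) i)
      ≤ ∑ i, q i * ((1 - θ) * z n i + θ * z (n - 1) i) *
          (∑ k ∈ Icc 1 n, A (n - k) * (z k i - z (k - 1) i)) := by
  obtain ⟨N, rfl⟩ : ∃ N, n = N + 1 := ⟨n - 1, by omega⟩
  have hsum (f : ℕ → ℝ) : ∑ k ∈ Icc 1 (N + 1), f k = ∑ j ∈ range (N + 1), f (j + 1) := by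
    rw [range_eq_Ico, sum_Ico_add' f 0 (N + 1) 1]
    rfl
  simp only [hsum, Nat.add_sub_cancel, Nat.add_sub_add_right]
  have hscalar (i : Fin m) := half_sum_sq_sub_le_interpolated (fun j => A (N - j))
    (fun k => z k i) N A1 θ
    (by
      rw [hA1]
      cases N with
      | zero => simp
      | succ M => simp)
    (by simpa using hA1lt) (fun j _ => hApos _ (by omega))
    (fun j hj => by
      have h := hAmono (N - (j + 1)) (by omega)
      rwa [show N - (j + 1) + 1 = N - j by omega] at h)
    hθ0 hθ1 (by simpa using hθA)
  calc
    _ = ∑ i, q i * ((1 / 2) * ∑ j ∈ range (N + 1),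
          A (N - j) * (z (j + 1) i * z (j + 1) i - z j i * z j i)) := by
      simp only [← sum_sub_distrib, mul_sum]
      rw [sum_comm]
      exact sum_congr rfl fun i _ => sum_congr rfl fun j _ => by ring
    _ ≤ _ := sum_le_sum fun i _ => by
      rw [mul_assoc]
      exact mul_le_mul_of_nonneg_left (hscalar i) (hq i).le
end

section
/- Let m, n ≥ 1 be integers, let A_0 ≥ A_1 ≥ ⋯ ≥ A_{n−1} > 0 be real numbers (with the convention A_1 := 0 when n = 1), and let θ ∈ [0,1) satisfy A_1 < A_0 and θ/(A_0 − A_1) ≤ (1−θ)/A_0. Let Q^{(0)}, Q^{(1)}, …, Q^{(n)} ∈ ℝ^{m×m} be diagonal matrices with positive diagonal entries such that each diagonal entry is non-increasing in the index, i.e. (Q^{(k+1)})_{ii} ≤ (Q^{(k)})_{ii} for all i and 0 ≤ k ≤ n−1. Then for any vectors z^0, …, z^n ∈ ℝ^m, writing z^{n−θ} := (1−θ)z^n + θz^{n−1} and w := ∑_{k=1}^n A_{n−k}(z^k − z^{k−1}), one has (z^{n−θ})ᵀ Q^{(n)} w ≥ (1/2) ∑_{k=1}^n A_{n−k} [ (z^k)ᵀQ^{(k)}z^k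 − (z^{k−1})ᵀQ^{(k−1)}z^{k−1} ]. -/
open Finset

/-- Summation by parts for a kernel `a` that vanishes at `0`. -/
theorem sum_mul_sub_eq_of_zero (a f : ℕ → ℝ) (ha0 : a 0 = 0) (n : ℕ) :
    ∑ k ∈ range n, a (k + 1) * (f (k + 1) - f k) =
      a n * f n - ∑ k ∈ range n, (a (k + 1) - a k) * f k := by
  induction n with
  | zero => simp [ha0]
  | succ n ih => rw [sum_range_succ, sum_range_succ, ih]; ring

/-- The unweighted Alikhanov inequality for scalar sequences. -/
theorem alikhanov_inequality (a z : ℕ → ℝ) (n : ℕ) (ha0 : a 0 = 0)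
    (ha : ∀ k ≤ n, a k ≤ a (k + 1)) (θ : ℝ) (hθ0 : 0 ≤ θ)
    (hlt : a n < a (n + 1)) (hpos : 0 < a (n + 1))
    (hθ : θ / (a (n + 1) - a n) ≤ (1 - θ) / a (n + 1)) :
    ∑ k ∈ range (n + 1), a (k + 1) * (z (k + 1) ^ 2 - z k ^ 2) ≤
      2 * ((1 - θ) * z (n + 1) + θ * z n) *
        ∑ k ∈ range (n + 1), a (k + 1) * (z (k + 1) - z k) := by
  set N := n + 1 with hN
  set w := ∑ k ∈ range N, a (k + 1) * (z (k + 1) - z k) with hw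
  set V := ∑ k ∈ range N, (a (k + 1) - a k) * (z N - z k) ^ 2 with hV
  have hc : ∀ k ∈ range N, 0 ≤ a (k + 1) - a k := fun k hk =>
    sub_nonneg.2 (ha k (Nat.lt_succ_iff.1 (mem_range.1 hk)))
  have hsum : ∑ k ∈ range N, (a (k + 1) - a k) = a N := by
    rw [sum_range_sub, ha0, sub_zero]
  have hw' : w = ∑ k ∈ range N, (a (k + 1) - a k) * (z N - z k) := by
    rw [hw, sum_mul_sub_eq_of_zero a z ha0]
    simp only [mul_sub, sum_sub_distrib, ← sum_mul, hsum]
  have hS : ∑ k ∈ range N, a (k + 1) * (z (k + 1) ^ 2 - z k ^ 2) = 2 * z N * w - V := by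
    have h1 : V = a N * z N ^ 2 - 2 * z N * ∑ k ∈ range N, (a (k + 1) - a k) * z k +
        ∑ k ∈ range N, (a (k + 1) - a k) * z k ^ 2 := by
      rw [hV, ← hsum, sum_mul, mul_sum, ← sum_sub_distrib, ← sum_add_distrib]
      exact sum_congr rfl fun k _ => by ring
    rw [h1, hw, sum_mul_sub_eq_of_zero a z ha0,
      sum_mul_sub_eq_of_zero a (fun k => z k ^ 2) ha0]
    ring
  have hCS : w ^ 2 ≤ a N * V := by
    rw [hw', ← hsum]
    exact sum_sq_le_sum_mul_sum_of_sq_le_mul _ hc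
      (fun k hk => mul_nonneg (hc k hk) (sq_nonneg _)) fun k _ => le_of_eq (by ring)
  have hVd : (a N - a n) * (z N - z n) ^ 2 ≤ V :=
    single_le_sum (f := fun k => (a (k + 1) - a k) * (z N - z k) ^ 2)
      (fun k hk => mul_nonneg (hc k hk) (sq_nonneg _)) (mem_range.2 n.lt_succ_self)
  have hcpos : 0 < a N - a n := sub_pos.2 hlt
  have hθ1 : 0 ≤ 1 - θ := by
    have := (div_nonneg hθ0 hcpos.le).trans hθ
    simpa using (le_div_iff₀ hpos).1 this
  have hVw : θ / (a N - a n) * w ^ 2 ≤ (1 - θ) * V :=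
    calc θ / (a N - a n) * w ^ 2 ≤ (1 - θ) / a N * (a N * V) := by gcongr
      _ = (1 - θ) * V := by field_simp
  have hsq : 2 * θ * (z N - z n) * w ≤
      θ / (a N - a n) * w ^ 2 + θ * ((a N - a n) * (z N - z n) ^ 2) := by
    have h0 : 0 ≤ θ / (a N - a n) * (w - (a N - a n) * (z N - z n)) ^ 2 := by positivity
    have h1 : θ / (a N - a n) * (w - (a N - a n) * (z N - z n)) ^ 2 =
        θ / (a N - a n) * w ^ 2 + θ * ((a N - a n) * (z N - z n) ^ 2) -
          2 * θ * (z N - z n) * w := by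
      field_simp
      ring
    linarith
  rw [hS]
  linarith [mul_le_mul_of_nonneg_left hVd hθ0]

/-- The Alikhanov inequality for scalar sequences with a weight `q` minimal at the last index. -/
theorem weighted_alikhanov_inequality (a q z : ℕ → ℝ) (n : ℕ) (ha0 : a 0 = 0)
    (ha : ∀ k ≤ n, a k ≤ a (k + 1)) (hq0 : 0 ≤ q (n + 1)) (hq : ∀ k ≤ n, q (n + 1) ≤ q k)
    (θ : ℝ) (hθ0 : 0 ≤ θ) (hlt : a n < a (n + 1)) (hpos : 0 < a (n + 1))
    (hθ : θ / (a (n + 1) - a n) ≤ (1 - θ) / a (n + 1)) :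
    ∑ k ∈ range (n + 1), a (k + 1) * (q (k + 1) * z (k + 1) ^ 2 - q k * z k ^ 2) ≤
      2 * (q (n + 1) * ((1 - θ) * z (n + 1) + θ * z n) *
        ∑ k ∈ range (n + 1), a (k + 1) * (z (k + 1) - z k)) := by
  calc ∑ k ∈ range (n + 1), a (k + 1) * (q (k + 1) * z (k + 1) ^ 2 - q k * z k ^ 2)
      = a (n + 1) * (q (n + 1) * z (n + 1) ^ 2) -
          ∑ k ∈ range (n + 1), (a (k + 1) - a k) * (q k * z k ^ 2) :=
        sum_mul_sub_eq_of_zero a (fun k => q k * z k ^ 2) ha0 (n + 1)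
    _ ≤ a (n + 1) * (q (n + 1) * z (n + 1) ^ 2) -
          ∑ k ∈ range (n + 1), (a (k + 1) - a k) * (q (n + 1) * z k ^ 2) := by
        refine sub_le_sub_left (sum_le_sum fun k hk => ?_) _
        have hk' : k ≤ n := Nat.lt_succ_iff.1 (mem_range.1 hk)
        exact mul_le_mul_of_nonneg_left
          (mul_le_mul_of_nonneg_right (hq k hk') (sq_nonneg _)) (sub_nonneg.2 (ha k hk'))
    _ = q (n + 1) * ∑ k ∈ range (n + 1), a (k + 1) * (z (k + 1) ^ 2 - z k ^ 2) := by
        rw [← sum_mul_sub_eq_of_zero a (fun k => q (n + 1) * z k ^ 2) ha0, mul_sum]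
        exact sum_congr rfl fun k _ => by ring
    _ ≤ q (n + 1) * (2 * ((1 - θ) * z (n + 1) + θ * z n) *
          ∑ k ∈ range (n + 1), a (k + 1) * (z (k + 1) - z k)) :=
        mul_le_mul_of_nonneg_left
          (alikhanov_inequality a z n ha0 ha θ hθ0 hlt hpos hθ) hq0
    _ = _ := by ring

/-- Lemma 2.1, inequality (2.2) of the paper.
With time-dependent diagonal weight matrices `Q^{(k)}` whose (positive) diagonal entries
are non-increasing in the time index, and non-increasing positive kernels
`A 0 ≥ A 1 ≥ ⋯ ≥ A (n-1) > 0` (convention `A 1 := 0` for `n = 1`), and `θ ∈ [0,1)`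
with `θ/(A 0 − A 1) ≤ (1−θ)/A 0`, one has
`(z^{n−θ})ᵀ Q^{(n)} w ≥ (1/2) ∑_{k=1}^n A_{n−k} [(z^k)ᵀQ^{(k)}z^k − (z^{k−1})ᵀQ^{(k−1)}z^{k−1}]`,
where `w = ∑_{k=1}^n A_{n−k} (z^k − z^{k−1})`. -/
theorem stmt1 (m n : ℕ) (hm : 1 ≤ m) (hn : 1 ≤ n)
    (Q : ℕ → Fin m → ℝ)
    (hQpos : ∀ k, k ≤ n → ∀ i, 0 < Q k i)
    (hQmono : ∀ k, k ≤ n - 1 → ∀ i, Q (k + 1) i ≤ Q k i)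
    (A : ℕ → ℝ)
    (hApos : ∀ k, k < n → 0 < A k)
    (hAmono : ∀ k, k + 1 < n → A (k + 1) ≤ A k)
    (θ : ℝ) (hθ0 : 0 ≤ θ) (hθ1 : θ < 1)
    (A1 : ℝ) (hA1 : A1 = if n = 1 then 0 else A 1)
    (hA1lt : A1 < A 0)
    (hθA : θ / (A 0 - A1) ≤ (1 - θ) / A 0)
    (z : ℕ → Fin m → ℝ) :
    (1 / 2) * ∑ k ∈ Icc 1 n, A (n - k) *
        ((∑ i, Q k i * z k i * z k i) - ∑ i, Q (k - 1) i * z (k - 1) i * z (k - 1) i)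
      ≤ ∑ i, Q n i * ((1 - θ) * z n i + θ * z (n - 1) i) *
          (∑ k ∈ Icc 1 n, A (n - k) * (z k i - z (k - 1) i)) := by
  obtain ⟨p, rfl⟩ : ∃ p, n = p + 1 := ⟨n - 1, by omega⟩
  set a : ℕ → ℝ := fun k => if k = 0 then 0 else A (p + 1 - k) with ha_def
  have ha0 : a 0 = 0 := by simp [ha_def]
  have haS : ∀ k, a (k + 1) = A (p + 1 - (k + 1)) := fun k => by simp [ha_def]
  have haN : a (p + 1) = A 0 := by simp [ha_def]
  have hap : a p = A1 := by
    rw [hA1]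
    rcases p with _ | p <;> simp [ha_def]
  have ha : ∀ k ≤ p, a k ≤ a (k + 1) := by
    intro k hk
    rw [haS]
    rcases k with _ | k
    · rw [ha0]
      exact (hApos _ (by omega)).le
    · rw [haS]
      have h := hAmono (p + 1 - (k + 1 + 1)) (by omega)
      rwa [show p + 1 - (k + 1 + 1) + 1 = p + 1 - (k + 1) by omega] at h
  have hQmin : ∀ i, ∀ k ≤ p, Q (p + 1) i ≤ Q k i := fun i k hk =>
    Nat.decreasingInduction' (P := fun j => Q (p + 1) i ≤ Q j i)
      (fun j hj _ h => h.trans (hQmono j (by omega) i)) (by omega) le_rfl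
  have hreindex : ∀ f : ℕ → ℝ, ∑ k ∈ Icc 1 (p + 1), A (p + 1 - k) * (f k - f (k - 1)) =
      ∑ k ∈ range (p + 1), a (k + 1) * (f (k + 1) - f k) := by
    intro f
    rw [← Ico_add_one_right_eq_Icc, sum_Ico_eq_sum_range]
    refine sum_congr (by simp) fun k _ => ?_
    rw [haS, add_comm 1 k, Nat.add_sub_cancel]
  have hcomp : ∀ i, ∑ k ∈ range (p + 1),
      a (k + 1) * (Q (k + 1) i * z (k + 1) i ^ 2 - Q k i * z k i ^ 2) ≤
        2 * (Q (p + 1) i * ((1 - θ) * z (p + 1) i + θ * z p i) *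
          ∑ k ∈ range (p + 1), a (k + 1) * (z (k + 1) i - z k i)) := fun i =>
    weighted_alikhanov_inequality a (fun k => Q k i) (fun k => z k i) p ha0 ha
      (hQpos _ le_rfl i).le (hQmin i) θ hθ0 (by rwa [hap, haN])
      (by rw [haN]; exact hApos 0 (by omega)) (by rwa [hap, haN])
  have hleft := hreindex fun k => ∑ i, Q k i * z k i * z k i
  have hright := fun i => hreindex fun k => z k i
  simp only [hleft, hright, Nat.add_sub_cancel]
  have hswap : ∑ k ∈ range (p + 1), a (k + 1) *
      ((∑ i, Q (k + 1) i * z (k + 1) i * z (k + 1) i) - ∑ i, Q k i * z k i * z k i) =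
      ∑ i, ∑ k ∈ range (p + 1),
        a (k + 1) * (Q (k + 1) i * z (k + 1) i ^ 2 - Q k i * z k i ^ 2) := by
    rw [sum_comm]
    refine sum_congr rfl fun k _ => ?_
    rw [← sum_sub_distrib, mul_sum]
    exact sum_congr rfl fun i _ => by ring
  have htotal := sum_le_sum fun i (_ : i ∈ univ) => hcomp i
  rw [← mul_sum] at htotal
  rw [hswap]
  linarith
end

section
/- Let m, n ≥ 1 be integers, let Q ∈ ℝ^{m×m} be a diagonal matrix with positive diagonal entries, and let A_0 ≥ A_1 ≥ ⋯ ≥ A_{n−1} > 0 be real numbers. Then for any vectors z^0, …, z^n ∈ ℝ^m, writing w := ∑_{k=1}^n A_{n−k}(z^k − z^{k−1}), one has 2 (z^n)ᵀ Q w ≥ ∑_{k=1}^n A_{n−k} [ (z^k)ᵀQz^k − (z^{k−1})ᵀQz^{k−1} ] + (1/A_0) wᵀQw. -/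
open Finset

/-- Scalar inequality for a non-decreasing positive weight `B`, by summation from the left. -/
theorem sq_sum_add_mul_sum_le (B y : ℕ → ℝ) (j : ℕ) (hj : 1 ≤ j)
    (hpos : ∀ k, 1 ≤ k → k ≤ j → 0 < B k)
    (hmono : ∀ k, 1 ≤ k → k + 1 ≤ j → B k ≤ B (k + 1)) :
    (∑ k ∈ Icc 1 j, B k * (y k - y (k - 1))) ^ 2
        + B j * ∑ k ∈ Icc 1 j, B k * (y k ^ 2 - y (k - 1) ^ 2)
      ≤ 2 * B j * y j * ∑ k ∈ Icc 1 j, B k * (y k - y (k - 1)) := by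
  induction j, hj using Nat.le_induction with
  | base =>
    simp only [Icc_self, sum_singleton]
    exact le_of_eq (by ring)
  | succ j hj ih =>
    have ih' := ih (fun k h1 h2 => hpos k h1 (by lia)) (fun k h1 h2 => hmono k h1 (by lia))
    have hB := hpos j hj (by lia)
    have hd := hmono j hj le_rfl
    rw [sum_Icc_succ_top (by lia), sum_Icc_succ_top (by lia), Nat.add_sub_cancel]
    generalize (∑ k ∈ Icc 1 j, B k * (y k - y (k - 1))) = D at ih' ⊢
    generalize (∑ k ∈ Icc 1 j, B k * (y k ^ 2 - y (k - 1) ^ 2)) = E at ih' ⊢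
    generalize B j = b at *
    generalize B (j + 1) = c at *
    generalize y j = u at *
    generalize y (j + 1) = v at *
    have hE : D ^ 2 + c * E ≤ 2 * c * u * D := by
      have h1 : E ≤ 2 * u * D := by
        by_contra! h
        nlinarith [mul_pos hB (sub_pos.2 h), sq_nonneg D]
      nlinarith [mul_nonneg (sub_nonneg.2 hd) (sub_nonneg.2 h1)]
    linear_combination hE

/-- inequality (A.1)/(7.2) of the paper.
For a diagonal matrix `Q` with positive diagonal entries `q i` and non-increasing positive
kernels `A 0 ≥ A 1 ≥ ⋯ ≥ A (n-1) > 0`, one has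
`2 (z^n)ᵀ Q w ≥ ∑_{k=1}^n A_{n−k} [(z^k)ᵀQz^k − (z^{k−1})ᵀQz^{k−1}] + (1/A 0) wᵀQw`,
where `w = ∑_{k=1}^n A_{n−k}(z^k − z^{k−1})`. -/
theorem stmt2 (m n : ℕ) (hm : 1 ≤ m) (hn : 1 ≤ n)
    (q : Fin m → ℝ) (hq : ∀ i, 0 < q i)
    (A : ℕ → ℝ)
    (hApos : ∀ k, k < n → 0 < A k)
    (hAmono : ∀ k, k + 1 < n → A (k + 1) ≤ A k)
    (z : ℕ → Fin m → ℝ) :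
    (∑ k ∈ Icc 1 n, A (n - k) *
        ((∑ i, q i * z k i * z k i) - ∑ i, q i * z (k - 1) i * z (k - 1) i))
      + (1 / A 0) * ∑ i, q i *
          (∑ k ∈ Icc 1 n, A (n - k) * (z k i - z (k - 1) i)) *
          (∑ k ∈ Icc 1 n, A (n - k) * (z k i - z (k - 1) i))
      ≤ 2 * ∑ i, q i * z n i *
          (∑ k ∈ Icc 1 n, A (n - k) * (z k i - z (k - 1) i)) := by
  have hA0 : 0 < A 0 := hApos 0 hn
  have key : ∀ i, (∑ k ∈ Icc 1 n, A (n - k) * (z k i ^ 2 - z (k - 1) i ^ 2))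
      + 1 / A 0 * (∑ k ∈ Icc 1 n, A (n - k) * (z k i - z (k - 1) i)) ^ 2
      ≤ 2 * z n i * ∑ k ∈ Icc 1 n, A (n - k) * (z k i - z (k - 1) i) := by
    intro i
    have h := sq_sum_add_mul_sum_le (fun k => A (n - k)) (fun k => z k i) n hn
      (fun k h1 _ => hApos _ (by lia))
      (fun k h1 h2 => by
        have := hAmono (n - (k + 1)) (by lia)
        rwa [show n - (k + 1) + 1 = n - k by lia] at this)
    simp only [Nat.sub_self] at h
    refine le_of_mul_le_mul_left ?_ hA0
    rw [mul_add, ← mul_assoc (A 0) (1 / A 0), mul_one_div_cancel hA0.ne']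
    linarith
  have hE : (∑ k ∈ Icc 1 n, A (n - k) *
        ((∑ i, q i * z k i * z k i) - ∑ i, q i * z (k - 1) i * z (k - 1) i))
      = ∑ i, q i * ∑ k ∈ Icc 1 n, A (n - k) * (z k i ^ 2 - z (k - 1) i ^ 2) := by
    simp only [← sum_sub_distrib, mul_sum]
    rw [sum_comm]
    exact sum_congr rfl fun i _ => sum_congr rfl fun k _ => by ring
  rw [hE, mul_sum, mul_sum, ← sum_add_distrib]
  refine sum_le_sum fun i _ => ?_
  have hqi := (hq i).le
  linear_combination q i * key i
end

section
/- Let m, n ≥ 1 be integers, let Q ∈ ℝ^{m×m} be a diagonal matrix with positive diagonal entries, and let A_0 ≥ A_1 ≥ ⋯ ≥ A_{n−1} > 0 be real numbers (with the convention A_1 := 0 when n = 1) such that A_1 < A_0. Then for any vectors z^0, …, z^n ∈ ℝ^m, writing w := ∑_{k=1}^n A_{n−k}(z^k − z^{k−1}), one has 2 (z^{n−1})ᵀ Q w ≥ ∑_{k=1}^n A_{n−k} [ (z^k)ᵀQz^k − (z^{k−1})ᵀQz^{k−1} ] − (1/(A_0 − A_1)) wᵀQw. -/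
open Finset

/-- Jensen's inequality for the Abel-summed form of an increasing positive kernel. -/
lemma sq_abel_sum_le (a y : ℕ → ℝ) (N : ℕ) (hN : 1 ≤ N)
    (hpos : ∀ k, 1 ≤ k → k ≤ N → 0 < a k)
    (hmono : ∀ k, 1 ≤ k → k < N → a k ≤ a (k + 1)) :
    (a N * y N - ∑ k ∈ Icc 1 N, a k * (y k - y (k - 1))) ^ 2
      ≤ a N * (a N * y N ^ 2 - ∑ k ∈ Icc 1 N, a k * (y k ^ 2 - y (k - 1) ^ 2)) := by
  induction N, hN using Nat.le_induction with
  | base =>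
    simp only [Icc_self, sum_singleton, Nat.sub_self]
    apply le_of_eq
    ring
  | succ N hN ih =>
    have ih := ih (fun k h1 h2 => hpos k h1 (by omega)) (fun k h1 h2 => hmono k h1 (by omega))
    have ha := hpos N hN (by omega)
    have hd := hmono N hN (by omega)
    rw [sum_Icc_succ_top (by omega), sum_Icc_succ_top (by omega), Nat.add_sub_cancel]
    set U := ∑ k ∈ Icc 1 N, a k * (y k - y (k - 1))
    set T := ∑ k ∈ Icc 1 N, a k * (y k ^ 2 - y (k - 1) ^ 2)
    have key : 0 ≤ a N * y N ^ 2 + (a N * y N ^ 2 - T) - 2 * (a N * y N - U) * y N := by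
      refine nonneg_of_mul_nonneg_right (a := a N) ?_ ha
      nlinarith [sq_nonneg (a N * y N - U - a N * y N)]
    nlinarith [mul_nonneg (sub_nonneg.2 hd) key]

/-- The scalar version of the discrete fractional chain inequality at the previous time level. -/
lemma sum_mul_sq_sub_sq_le (n : ℕ) (hn : 1 ≤ n) (A : ℕ → ℝ)
    (hApos : ∀ k, k < n → 0 < A k)
    (hAmono : ∀ k, k + 1 < n → A (k + 1) ≤ A k)
    (A1 : ℝ) (hA1 : A1 = if n = 1 then 0 else A 1)
    (hA1lt : A1 < A 0) (x : ℕ → ℝ) :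
    (∑ k ∈ Icc 1 n, A (n - k) * (x k ^ 2 - x (k - 1) ^ 2))
      - (1 / (A 0 - A1)) * (∑ k ∈ Icc 1 n, A (n - k) * (x k - x (k - 1))) ^ 2
      ≤ 2 * x (n - 1) * ∑ k ∈ Icc 1 n, A (n - k) * (x k - x (k - 1)) := by
  have hD : 0 < A 0 - A1 := sub_pos.2 hA1lt
  obtain ⟨N, rfl⟩ : ∃ N, n = N + 1 := ⟨n - 1, by omega⟩
  rw [sum_Icc_succ_top (by omega), sum_Icc_succ_top (by omega), Nat.add_sub_cancel, Nat.sub_self]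
  suffices h : ∀ U T y c : ℝ,
      (A 0 - A1) * (T - 2 * c * U + A 0 * (y - c) ^ 2) ≤ (U + A 0 * (y - c)) ^ 2 →
      T + A 0 * (y ^ 2 - c ^ 2) - 1 / (A 0 - A1) * (U + A 0 * (y - c)) ^ 2
        ≤ 2 * c * (U + A 0 * (y - c)) by
    apply h
    rcases Nat.eq_zero_or_pos N with rfl | hN
    · simp only [if_true, zero_add] at hA1
      simp only [hA1, zero_add, Icc_eq_empty_of_lt Nat.zero_lt_one, sum_empty]
      apply le_of_eq
      ring
    · rw [if_neg (by omega)] at hA1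
      have hJ := sq_abel_sum_le (fun k => A (N + 1 - k)) (fun k => x k - x N) N hN
        (fun k h1 h2 => hApos _ (by omega))
        (fun k h1 h2 => by
          have h := hAmono (N + 1 - (k + 1)) (by omega)
          rwa [show N + 1 - (k + 1) + 1 = N + 1 - k by omega] at h)
      have hT : ∑ k ∈ Icc 1 N, A (N + 1 - k) * ((x k - x N) ^ 2 - (x (k - 1) - x N) ^ 2)
          = (∑ k ∈ Icc 1 N, A (N + 1 - k) * (x k ^ 2 - x (k - 1) ^ 2))
            - 2 * x N * ∑ k ∈ Icc 1 N, A (N + 1 - k) * (x k - x (k - 1)) := by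
        rw [mul_sum, ← sum_sub_distrib]
        exact sum_congr rfl fun k _ => by ring
      simp only [hT, sub_sub_sub_cancel_right, Nat.add_sub_cancel_left, ← hA1] at hJ
      have h1 : 0 < A1 := hA1 ▸ hApos 1 (by omega)
      set U := ∑ k ∈ Icc 1 N, A (N + 1 - k) * (x k - x (k - 1))
      set T := ∑ k ∈ Icc 1 N, A (N + 1 - k) * (x k ^ 2 - x (k - 1) ^ 2)
      have hJ' : U ^ 2 ≤ - (A1 * (T - 2 * x N * U)) := by linarith
      have h0 : 0 ≤ A 0 * (A1 * (x (N + 1) - x N) + U) ^ 2 :=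
        mul_nonneg (h1.trans hA1lt).le (sq_nonneg _)
      have hm := mul_le_mul_of_nonneg_left hJ' hD.le
      refine le_of_mul_le_mul_left ?_ h1
      linarith
  intro U T y c h
  have h' := (le_div_iff₀' hD).2 h
  rw [one_div_mul_eq_div]
  linarith

/-- inequality (A.2)/(7.3) of the paper.
For a diagonal matrix `Q` with positive diagonal entries `q i` and non-increasing positive
kernels `A 0 ≥ A 1 ≥ ⋯ ≥ A (n-1) > 0` with `A 1 < A 0` (convention `A 1 := 0` when `n = 1`),
one has
`2 (z^{n-1})ᵀ Q w ≥ ∑_{k=1}^n A_{n−k} [(z^k)ᵀQz^k − (z^{k−1})ᵀQz^{k−1}] − (1/(A 0 − A 1)) wᵀQw`,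
where `w = ∑_{k=1}^n A_{n−k}(z^k − z^{k−1})`. -/
theorem stmt3 (m n : ℕ) (hm : 1 ≤ m) (hn : 1 ≤ n)
    (q : Fin m → ℝ) (hq : ∀ i, 0 < q i)
    (A : ℕ → ℝ)
    (hApos : ∀ k, k < n → 0 < A k)
    (hAmono : ∀ k, k + 1 < n → A (k + 1) ≤ A k)
    (A1 : ℝ) (hA1 : A1 = if n = 1 then 0 else A 1)
    (hA1lt : A1 < A 0)
    (z : ℕ → Fin m → ℝ) :
    (∑ k ∈ Icc 1 n, A (n - k) *
        ((∑ i, q i * z k i * z k i) - ∑ i, q i * z (k - 1) i * z (k - 1) i))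
      - (1 / (A 0 - A1)) * ∑ i, q i *
          (∑ k ∈ Icc 1 n, A (n - k) * (z k i - z (k - 1) i)) *
          (∑ k ∈ Icc 1 n, A (n - k) * (z k i - z (k - 1) i))
      ≤ 2 * ∑ i, q i * z (n - 1) i *
          (∑ k ∈ Icc 1 n, A (n - k) * (z k i - z (k - 1) i)) := by
  have hs := sum_le_sum fun i (_ : i ∈ (univ : Finset (Fin m))) =>
    mul_le_mul_of_nonneg_left
      (sum_mul_sq_sub_sq_le n hn A hApos hAmono A1 hA1 hA1lt fun k => z k i) (hq i).le
  refine (le_of_eq ?_).trans (hs.trans (le_of_eq ?_))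
  · simp only [mul_sub (q _), sum_sub_distrib]
    congr 1
    · simp only [← sum_sub_distrib, mul_sum]
      rw [sum_comm]
      exact sum_congr rfl fun i _ => sum_congr rfl fun k _ => by ring
    · rw [mul_sum]
      exact sum_congr rfl fun i _ => by ring
  · rw [mul_sum]
    exact sum_congr rfl fun i _ => by ring
end

section
/- Let T > 0, α ∈ (1,2), β := α/2, and let u : [0,T] → ℝ be twice continuously differentiable. Then for every t ∈ (0,T], (1/Γ(2−α)) ∫_0^t (t−s)^{1−α} u″(s) ds = D^β(D^β u)(t) − u′(0) · t^{1−α}/Γ(2−α), where D^β g(t) := (1/Γ(1−β)) ∫_0^t (t−s)^{−β} g′(s) ds denotes the Caputo derivative of order β ∈ (0,1), and the outer D^β is applied to the function t ↦ D^β u(t). -/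
/-- The Caputo fractional derivative of order `β ∈ (0,1)` of a function `g` on `[0,T]`:
`D^β g(t) = (1/Γ(1−β)) ∫_0^t (t−s)^{−β} g'(s) ds`. -/
noncomputable def caputoLow (T β : ℝ) (g : ℝ → ℝ) (t : ℝ) : ℝ :=
  (Real.Gamma (1 - β))⁻¹ *
    ∫ s in (0 : ℝ)..t, (t - s) ^ (-β) * derivWithin g (Set.Icc (0 : ℝ) T) s

open MeasureTheory Set ContinuousLinearMap Filter Topology
open scoped Convolution

/-- The Riemann–Liouville kernel `ω_a(t) = t^{a-1}/Γ(a)`, extended by zero to `t ≤ 0`. -/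
noncomputable def rlKernel (a t : ℝ) : ℝ :=
  (Ioi (0 : ℝ)).indicator (fun t => t ^ (a - 1) / Real.Gamma a) t

lemma rlKernel_of_pos (a : ℝ) {t : ℝ} (ht : 0 < t) :
    rlKernel a t = t ^ (a - 1) / Real.Gamma a :=
  indicator_of_mem (mem_Ioi.2 ht) _

lemma rlKernel_of_nonpos (a : ℝ) {t : ℝ} (ht : t ≤ 0) : rlKernel a t = 0 :=
  indicator_of_notMem (by simpa using ht) _

lemma rlKernel_pos {a t : ℝ} (ha : 0 < a) (ht : 0 < t) : 0 < rlKernel a t := by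
  rw [rlKernel_of_pos a ht]
  exact div_pos (Real.rpow_pos_of_pos ht _) (Real.Gamma_pos_of_pos ha)

lemma rlKernel_nonneg {a : ℝ} (ha : 0 < a) (t : ℝ) : 0 ≤ rlKernel a t := by
  rcases le_or_gt t 0 with ht | ht
  · rw [rlKernel_of_nonpos a ht]
  · exact (rlKernel_pos ha ht).le

lemma rlKernel_one {t : ℝ} (ht : 0 < t) : rlKernel 1 t = 1 := by
  simp [rlKernel_of_pos 1 ht]

@[fun_prop]
lemma measurable_rlKernel (a : ℝ) : Measurable (rlKernel a) :=
  Measurable.indicator (by fun_prop) measurableSet_Ioi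

/-- Convolution with the Riemann–Liouville kernel is the fractional integral over `[0,t]`. -/
lemma convolution_rlKernel_eq_intervalIntegral {f : ℝ → ℝ} (hf : ∀ s ≤ 0, f s = 0) (a : ℝ)
    {t : ℝ} (ht : 0 ≤ t) :
    (f ⋆[mul ℝ ℝ, volume] rlKernel a) t =
      (Real.Gamma a)⁻¹ * ∫ s in (0 : ℝ)..t, (t - s) ^ (a - 1) * f s := by
  rw [convolution_def, ← intervalIntegral.integral_const_mul,
    intervalIntegral.integral_of_le ht, integral_Ioc_eq_integral_Ioo,
    ← integral_indicator measurableSet_Ioo]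
  congr 1 with s
  rw [mul_apply']
  by_cases hs : s ∈ Ioo 0 t
  · rw [indicator_of_mem hs, rlKernel_of_pos a (sub_pos.2 hs.2)]
    ring
  · rw [indicator_of_notMem hs]
    rcases le_or_gt s 0 with h0 | h0
    · rw [hf s h0, zero_mul]
    · rw [rlKernel_of_nonpos a (by simpa [h0] using hs), mul_zero]

lemma convolution_rlKernel_of_nonpos {f : ℝ → ℝ} (hf : ∀ s ≤ 0, f s = 0) (a : ℝ)
    {t : ℝ} (ht : t ≤ 0) : (f ⋆[mul ℝ ℝ, volume] rlKernel a) t = 0 := by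
  rw [convolution_def, integral_eq_zero_of_ae (.of_forall fun s => ?_)]
  rw [mul_apply', Pi.zero_apply]
  rcases le_or_gt s 0 with h0 | h0
  · rw [hf s h0, zero_mul]
  · rw [rlKernel_of_nonpos a (by linarith), mul_zero]

lemma integral_rpow_mul_sub_rpow {a b t : ℝ} (ha : 0 < a) (hb : 0 < b) (ht : 0 < t) :
    ∫ s in (0 : ℝ)..t, s ^ (a - 1) * (t - s) ^ (b - 1) =
      t ^ (a + b - 1) * (Real.Gamma a * Real.Gamma b / Real.Gamma (a + b)) := by
  have h := Complex.betaIntegral_scaled a b ht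
  rw [Complex.betaIntegral_eq_Gamma_mul_div _ _ (by simpa) (by simpa), ← Complex.ofReal_add,
    Complex.Gamma_ofReal, Complex.Gamma_ofReal, Complex.Gamma_ofReal] at h
  apply Complex.ofReal_injective
  rw [← intervalIntegral.integral_ofReal, Complex.ofReal_mul, Complex.ofReal_cpow ht.le]
  push_cast at h ⊢
  rw [← h]
  refine intervalIntegral.integral_congr fun s hs => ?_
  rw [uIcc_of_le ht.le] at hs
  rw [Complex.ofReal_cpow hs.1, Complex.ofReal_cpow (sub_nonneg.2 hs.2)]
  push_cast
  rfl

/-- The semigroup property of the Riemann–Liouville kernels. -/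
lemma rlKernel_convolution_rlKernel {a b : ℝ} (ha : 0 < a) (hb : 0 < b) :
    (rlKernel a ⋆[mul ℝ ℝ, volume] rlKernel b) = rlKernel (a + b) := by
  ext t
  rcases le_or_gt t 0 with ht | ht
  · rw [rlKernel_of_nonpos _ ht,
      convolution_rlKernel_of_nonpos (fun s hs => rlKernel_of_nonpos a hs) b ht]
  · have hΓa := (Real.Gamma_pos_of_pos ha).ne'
    have hΓb := (Real.Gamma_pos_of_pos hb).ne'
    rw [convolution_rlKernel_eq_intervalIntegral (fun s hs => rlKernel_of_nonpos a hs) b ht.le,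
      rlKernel_of_pos _ ht]
    have : ∫ s in (0 : ℝ)..t, (t - s) ^ (b - 1) * rlKernel a s =
        ∫ s in (0 : ℝ)..t, (Real.Gamma a)⁻¹ * (s ^ (a - 1) * (t - s) ^ (b - 1)) := by
      refine intervalIntegral.integral_congr_ae (.of_forall fun s hs => ?_)
      rw [uIoc_of_le ht.le] at hs
      rw [rlKernel_of_pos a hs.1]
      ring
    rw [this, intervalIntegral.integral_const_mul, integral_rpow_mul_sub_rpow ha hb ht]
    field_simp

lemma convolutionExistsAt_rlKernel_rlKernel {a b : ℝ} (ha : 0 < a) (hb : 0 < b) (t : ℝ) :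
    ConvolutionExistsAt (rlKernel a) (rlKernel b) t (mul ℝ ℝ) volume := by
  rcases le_or_gt t 0 with ht | ht
  · refine (integrable_zero ℝ ℝ volume).congr (.of_forall fun s => ?_)
    rw [Pi.zero_apply]
    beta_reduce
    rw [mul_apply']
    rcases le_or_gt s 0 with h0 | h0
    · rw [rlKernel_of_nonpos a h0, zero_mul]
    · rw [rlKernel_of_nonpos b (by linarith), mul_zero]
  · by_contra h
    have h' := congrFun (rlKernel_convolution_rlKernel ha hb) t
    rw [convolution_def, integral_undef h] at h'
    exact (rlKernel_pos (add_pos ha hb) ht).ne h'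

section Dominated

variable {f : ℝ → ℝ} {M a b c : ℝ}

lemma convolutionExistsAt_rlKernel (hf : Measurable f) (hfM : ∀ s, |f s| ≤ M * rlKernel c s)
    (hc : 0 < c) (ha : 0 < a) (t : ℝ) :
    ConvolutionExistsAt f (rlKernel a) t (mul ℝ ℝ) volume := by
  refine ((convolutionExistsAt_rlKernel_rlKernel hc ha t).const_mul M).mono'
    (Measurable.aestronglyMeasurable ?_) (.of_forall fun s => ?_)
  · simp only [mul_apply']
    fun_prop
  · rw [mul_apply', mul_apply', Real.norm_eq_abs, abs_mul, abs_of_nonneg (rlKernel_nonneg ha _),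
      ← mul_assoc]
    exact mul_le_mul_of_nonneg_right (hfM s) (rlKernel_nonneg ha _)

lemma abs_convolution_rlKernel_le (hf : Measurable f) (hfM : ∀ s, |f s| ≤ M * rlKernel c s)
    (hc : 0 < c) (ha : 0 < a) (t : ℝ) :
    |(f ⋆[mul ℝ ℝ, volume] rlKernel a) t| ≤ M * rlKernel (c + a) t := by
  rw [← rlKernel_convolution_rlKernel hc ha, convolution_def, convolution_def,
    ← integral_const_mul]
  refine abs_integral_le_integral_abs.trans (integral_mono
    (convolutionExistsAt_rlKernel hf hfM hc ha t).norm
    ((convolutionExistsAt_rlKernel_rlKernel hc ha t).const_mul M) fun s => ?_)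
  simp only [mul_apply']
  rw [abs_mul, abs_of_nonneg (rlKernel_nonneg ha _), ← mul_assoc]
  exact mul_le_mul_of_nonneg_right (hfM s) (rlKernel_nonneg ha _)

lemma measurable_convolution_rlKernel (hf : Measurable f) (a : ℝ) :
    Measurable (f ⋆[mul ℝ ℝ, volume] rlKernel a) := by
  refine StronglyMeasurable.measurable
    (StronglyMeasurable.integral_prod_right (Measurable.stronglyMeasurable ?_))
  simp only [mul_apply', Function.uncurry_def]
  fun_prop

lemma convolution_rlKernel_convolution_rlKernel (hf : Measurable f)
    (hfM : ∀ s, |f s| ≤ M * rlKernel c s) (hc : 0 < c) (ha : 0 < a) (hb : 0 < b) :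
    ((f ⋆[mul ℝ ℝ, volume] rlKernel a) ⋆[mul ℝ ℝ, volume] rlKernel b) =
      (f ⋆[mul ℝ ℝ, volume] rlKernel (a + b)) := by
  have hnorm : ∀ {e : ℝ}, 0 < e → (fun x => ‖rlKernel e x‖) = rlKernel e := fun he =>
    funext fun x => Real.norm_of_nonneg (rlKernel_nonneg he x)
  ext t
  rw [← rlKernel_convolution_rlKernel ha hb]
  refine convolution_assoc _ _ _ _ (fun x y z => mul_assoc x y z) hf.aestronglyMeasurable
    (measurable_rlKernel a).aestronglyMeasurable (measurable_rlKernel b).aestronglyMeasurable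
    (.of_forall (convolutionExistsAt_rlKernel hf hfM hc ha)) (.of_forall fun x => ?_) ?_
  · rw [hnorm ha, hnorm hb]
    exact convolutionExistsAt_rlKernel_rlKernel ha hb x
  · rw [hnorm ha, hnorm hb, rlKernel_convolution_rlKernel ha hb]
    exact convolutionExistsAt_rlKernel hf.norm (M := M) (c := c) (by simpa using hfM) hc
      (add_pos ha hb) t

lemma convolutionExistsAt_smul_rlKernel (ha : 0 < a) (hb : 0 < b) (k t : ℝ) :
    ConvolutionExistsAt (k • rlKernel a) (rlKernel b) t (mul ℝ ℝ) volume :=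
  convolutionExistsAt_rlKernel (M := |k|) (c := a) ((measurable_rlKernel a).const_smul k)
    (fun s => by simp [abs_mul, abs_of_nonneg (rlKernel_nonneg ha s)]) ha hb t

lemma convolutionExistsAt_convolution_rlKernel (hf : Measurable f)
    (hfM : ∀ s, |f s| ≤ M * rlKernel c s) (hc : 0 < c) (ha : 0 < a) (hb : 0 < b) (t : ℝ) :
    ConvolutionExistsAt (f ⋆[mul ℝ ℝ, volume] rlKernel a) (rlKernel b) t (mul ℝ ℝ) volume :=
  convolutionExistsAt_rlKernel (measurable_convolution_rlKernel hf a)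
    (abs_convolution_rlKernel_le hf hfM hc ha) (add_pos hc ha) hb t

/-- Fractional integration of order `b` of the Taylor-type expression `k ω_a + f ⋆ ω_a`. -/
lemma smul_rlKernel_add_convolution_convolution (hf : Measurable f)
    (hfM : ∀ s, |f s| ≤ M * rlKernel c s) (hc : 0 < c) (ha : 0 < a) (hb : 0 < b) (k : ℝ) :
    ((k • rlKernel a + (f ⋆[mul ℝ ℝ, volume] rlKernel a)) ⋆[mul ℝ ℝ, volume] rlKernel b) =
      k • rlKernel (a + b) + (f ⋆[mul ℝ ℝ, volume] rlKernel (a + b)) := by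
  rw [← convolution_rlKernel_convolution_rlKernel hf hfM hc ha hb,
    ← rlKernel_convolution_rlKernel ha hb, ← smul_convolution]
  exact ConvolutionExists.add_distrib (convolutionExistsAt_smul_rlKernel ha hb k)
    (convolutionExistsAt_convolution_rlKernel hf hfM hc ha hb)

end Dominated

lemma convolution_rlKernel_one {h : ℝ → ℝ} (hh : ∀ s ≤ 0, h s = 0) {t : ℝ} (ht : 0 ≤ t) :
    (h ⋆[mul ℝ ℝ, volume] rlKernel 1) t = ∫ s in (0 : ℝ)..t, h s := by
  simp [convolution_rlKernel_eq_intervalIntegral hh 1 ht]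

lemma intervalIntegrable_of_convolutionExistsAt_rlKernel_one {h : ℝ → ℝ} {t : ℝ} (ht : 0 ≤ t)
    (hh : ConvolutionExistsAt h (rlKernel 1) t (mul ℝ ℝ) volume) :
    IntervalIntegrable h volume 0 t := by
  rw [intervalIntegrable_iff_integrableOn_Ioo_of_le ht]
  refine (hh.integrableOn (s := Ioo 0 t)).congr_fun (fun s hs => ?_) measurableSet_Ioo
  simp [rlKernel_one (sub_pos.2 hs.2)]

lemma caputoLow_eq_convolution {T β t : ℝ} {g h : ℝ → ℝ} (ht : 0 ≤ t) (hh : ∀ s ≤ 0, h s = 0)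
    (hgh : ∀ᵐ s, s ∈ Ioo 0 t → derivWithin g (Icc 0 T) s = h s) :
    caputoLow T β g t = (h ⋆[mul ℝ ℝ, volume] rlKernel (1 - β)) t := by
  rw [convolution_rlKernel_eq_intervalIntegral hh _ ht, caputoLow]
  congr 1
  rw [intervalIntegral.integral_of_le ht, intervalIntegral.integral_of_le ht,
    integral_Ioc_eq_integral_Ioo, integral_Ioc_eq_integral_Ioo]
  refine setIntegral_congr_ae measurableSet_Ioo (hgh.mono fun s hs hst => ?_)
  rw [hs hst, show 1 - β - 1 = -β by ring]

/-- A function agreeing on `(0,T)` with a primitive of an integrable `h` has derivative `h` almost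
everywhere. -/
lemma ae_derivWithin_eq_of_eq_integral {T : ℝ} {g h : ℝ → ℝ} (hT : 0 ≤ T)
    (hh : IntervalIntegrable h volume 0 T)
    (hgh : ∀ s ∈ Ioo 0 T, g s = ∫ r in (0 : ℝ)..s, h r) :
    ∀ᵐ s, s ∈ Ioo 0 T → derivWithin g (Icc 0 T) s = h s := by
  filter_upwards [hh.ae_hasDerivAt_integral] with s hs hsT
  have hd := hs (by rw [uIcc_of_le hT]; exact Ioo_subset_Icc_self hsT) 0 left_mem_uIcc
  rw [derivWithin_of_mem_nhds (Icc_mem_nhds hsT.1 hsT.2)]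
  exact (hd.congr_of_eventuallyEq
    (eventually_of_mem (Ioo_mem_nhds hsT.1 hsT.2) hgh)).deriv

/-- Lemma 4.1 of the paper, symmetric fractional-order reduction.
For `α ∈ (1,2)`, `β = α/2` and `u ∈ C²([0,T])`, for every `t ∈ (0,T]`:
`(1/Γ(2−α)) ∫_0^t (t−s)^{1−α} u''(s) ds = D^β(D^β u)(t) − u'(0) t^{1−α}/Γ(2−α)`. -/
theorem stmt6 (T α : ℝ) (hT : 0 < T) (hα1 : 1 < α) (hα2 : α < 2)
    (u : ℝ → ℝ) (hu : ContDiffOn ℝ 2 u (Set.Icc (0 : ℝ) T)) :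
    ∀ t ∈ Set.Ioc (0 : ℝ) T,
      (1 / Real.Gamma (2 - α)) *
          (∫ s in (0 : ℝ)..t, (t - s) ^ (1 - α) *
            derivWithin (derivWithin u (Set.Icc (0 : ℝ) T)) (Set.Icc (0 : ℝ) T) s)
        = caputoLow T (α / 2) (caputoLow T (α / 2) u) t
            - derivWithin u (Set.Icc (0 : ℝ) T) 0 * t ^ (1 - α) / Real.Gamma (2 - α) := by
  intro t ht
  set v := derivWithin u (Icc 0 T)
  set w := derivWithin v (Icc 0 T)
  have hvC : ContDiffOn ℝ 1 v (Icc 0 T) := hu.derivWithin (uniqueDiffOn_Icc hT) (by norm_num)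
  have hwC : ContinuousOn w (Icc 0 T) :=
    hvC.continuousOn_derivWithin (uniqueDiffOn_Icc hT) le_rfl
  obtain ⟨M, hM⟩ := isCompact_Icc.exists_bound_of_continuousOn hwC
  have hM0 : 0 ≤ M := (norm_nonneg _).trans (hM 0 (left_mem_Icc.2 hT.le))
  set f := (Ioc 0 T).indicator w with hf_def
  have hf0 : ∀ s ≤ 0, f s = 0 := fun s hs => indicator_of_notMem (fun h => hs.not_gt h.1) _
  have hfw : ∀ s ∈ Ioc 0 T, f s = w s := fun s hs => indicator_of_mem hs _
  have hf : Measurable f := by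
    classical
    rw [hf_def, ← piecewise_eq_indicator]
    exact (hwC.mono Ioc_subset_Icc_self).measurable_piecewise continuousOn_const
      measurableSet_Ioc
  have hfM : ∀ s, |f s| ≤ M * rlKernel 1 s := by
    intro s
    by_cases hs : s ∈ Ioc 0 T
    · rw [hfw s hs, rlKernel_one hs.1, mul_one]
      exact hM s (Ioc_subset_Icc_self hs)
    · rw [hf_def, indicator_of_notMem hs, abs_zero]
      exact mul_nonneg hM0 (rlKernel_nonneg one_pos s)
  set b := 1 - α / 2 with hb_def
  have hb : 0 < b := by rw [hb_def]; linarith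
  let F : ℝ → ℝ → ℝ := fun a => v 0 • rlKernel a + (f ⋆[mul ℝ ℝ, volume] rlKernel a)
  have hF0 : ∀ a, ∀ s ≤ 0, F a s = 0 := fun a s hs => by
    simp [F, rlKernel_of_nonpos a hs, convolution_rlKernel_of_nonpos hf0 a hs]
  have hFF : ∀ {a : ℝ}, 0 < a → ∀ {b : ℝ}, 0 < b →
      (F a ⋆[mul ℝ ℝ, volume] rlKernel b) = F (a + b) := fun ha _ hb =>
    smul_rlKernel_add_convolution_convolution hf hfM one_pos ha hb (v 0)
  have hFv : ∀ s ∈ Ioo 0 T, v s = F 1 s := by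
    intro s hs
    simp only [F, Pi.add_apply, Pi.smul_apply, rlKernel_one hs.1,
      convolution_rlKernel_one hf0 hs.1.le, smul_eq_mul, mul_one]
    have h := intervalIntegral.integral_eq_sub_of_hasDerivAt_of_le hs.1.le
      (hvC.continuousOn.mono (Icc_subset_Icc_right hs.2.le)) (f' := w) (fun r hr => ?_)
      ((hwC.mono (Icc_subset_Icc_right hs.2.le)).intervalIntegrable_of_Icc hs.1.le)
    · rw [intervalIntegral.integral_congr_ae (g := w) (.of_forall fun r hr => ?_), h]
      · ring
      · rw [uIoc_of_le hs.1.le] at hr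
        exact hfw r ⟨hr.1, hr.2.trans hs.2.le⟩
    · have hr' := Icc_mem_nhds hr.1 (hr.2.trans hs.2)
      exact ((hvC.differentiableOn one_ne_zero r (mem_of_mem_nhds hr')).hasDerivWithinAt).hasDerivAt
        hr'
  have hg : ∀ s ∈ Ioo 0 T, caputoLow T (α / 2) u s = ∫ r in (0 : ℝ)..s, F b r := by
    intro s hs
    rw [caputoLow_eq_convolution hs.1.le (hF0 1)
      (.of_forall fun r hr => hFv r ⟨hr.1, hr.2.trans hs.2⟩), hFF one_pos hb, add_comm,
      ← hFF hb one_pos, convolution_rlKernel_one (hF0 b) hs.1.le]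
  have hFint : IntervalIntegrable (F b) volume 0 T :=
    (intervalIntegrable_of_convolutionExistsAt_rlKernel_one hT.le
      (convolutionExistsAt_smul_rlKernel hb one_pos (v 0) T)).add
    (intervalIntegrable_of_convolutionExistsAt_rlKernel_one hT.le
      (convolutionExistsAt_convolution_rlKernel hf hfM one_pos hb one_pos T))
  have hout := caputoLow_eq_convolution (β := α / 2) ht.1.le (hF0 b)
    ((ae_derivWithin_eq_of_eq_integral hT.le hFint hg).mono
      fun s hs hst => hs ⟨hst.1, hst.2.trans_le ht.2⟩)
  rw [hout, hFF hb hb, show b + b = 2 - α by rw [hb_def]; ring]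
  simp only [F, Pi.add_apply, Pi.smul_apply, rlKernel_of_pos _ ht.1,
    convolution_rlKernel_eq_intervalIntegral hf0 _ ht.1.le, smul_eq_mul]
  have hfw_integral : ∫ s in (0 : ℝ)..t, (t - s) ^ (1 - α) * f s =
      ∫ s in (0 : ℝ)..t, (t - s) ^ (1 - α) * w s := by
    refine intervalIntegral.integral_congr_ae (.of_forall fun s hs => ?_)
    rw [uIoc_of_le ht.1.le] at hs
    rw [hfw s ⟨hs.1, hs.2.trans ht.2⟩]
  rw [show 2 - α - 1 = 1 - α by ring, hfw_integral]
  ring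
end

section
/- Let m, m_1, m_2 ≥ 1 and n ≥ 1 be integers, let S_1 ∈ ℝ^{m_1×m} and S_2 ∈ ℝ^{m_2×m} be arbitrary real matrices, and for k = 0, 1, …, n let P_1^{(k)} ∈ ℝ^{m_1×m_1} and P_2^{(k)} ∈ ℝ^{m_2×m_2} be diagonal matrices with positive diagonal entries whose diagonal entries are non-increasing in k. Let A_0 ≥ A_1 ≥ ⋯ ≥ A_{n−1} > 0 be real numbers (with the convention A_1 := 0 when n = 1) and let θ ∈ [0,1) satisfy A_1 < A_0 and θ/(A_0 − A_1) ≤ (1−θ)/A_0. Set A := S_1ᵀ P_1^{(n)} S_1 + S_2ᵀ P_2^{(n)} S_2. Then for any vectors u^0, …, u^n ∈ ℝ^m, writing u^{n−θ} := (1−θ)u^n + θu^{n−1} and w := ∑_{k=1}^n A_{n−k}(u^k − u^{k−1}), one has 2 (u^{n−θ})ᵀ A w ≥ A_0 [ (S_1u^n)ᵀP_1^{(n)}(S_1u^n) + (S_2u^n)ᵀP_2^{(n)}(S_2u^n) ] − ∑_{k=1}^{n−1} (A_{n−k−1} − A_{n−k}) [ (S_1u^k)ᵀP_1^{(k)}(S_1u^k)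 + (S_2u^k)ᵀP_2^{(k)}(S_2u^k) ] − A_{n−1} [ (S_1u^0)ᵀP_1^{(0)}(S_1u^0) + (S_2u^0)ᵀP_2^{(0)}(S_2u^0) ]. -/
open Finset Matrix

/-- Summation by parts, in the form adapted to discrete convolutions. -/
theorem sum_Icc_mul_sub_pred (B f : ℕ → ℝ) (N : ℕ) :
    ∑ k ∈ Icc 1 (N + 1), B k * (f k - f (k - 1))
      = B (N + 1) * f (N + 1) - (∑ k ∈ Icc 1 N, (B (k + 1) - B k) * f k) - B 1 * f 0 := by
  induction N with
  | zero => simp; ring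
  | succ N ih =>
    rw [Finset.sum_Icc_succ_top (by omega), ih,
      Finset.sum_Icc_succ_top (b := N) (by omega)]
    simp only [Nat.add_sub_cancel]
    ring

theorem sum_convolution_kernel_eq (A f : ℕ → ℝ) (n : ℕ) (hn : 1 ≤ n) :
    ∑ k ∈ Icc 1 n, A (n - k) * (f k - f (k - 1))
      = A 0 * f n - (∑ k ∈ Icc 1 (n - 1), (A (n - k - 1) - A (n - k)) * f k)
        - A (n - 1) * f 0 := by
  obtain ⟨N, rfl⟩ : ∃ N, n = N + 1 := ⟨n - 1, by omega⟩
  have h := sum_Icc_mul_sub_pred (fun k => A (N + 1 - k)) f N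
  simpa [Nat.sub_sub] using h

/-- The convolution of the kernel with the increments of `f` is nonpositive as soon as `f ≥ 0`
and the most recent history term dominates the current value. -/
theorem sum_convolution_kernel_nonpos (A f : ℕ → ℝ) (n : ℕ) (hn : 1 ≤ n)
    (hApos : ∀ k, k < n → 0 < A k)
    (hAmono : ∀ k, k + 1 < n → A (k + 1) ≤ A k)
    (hf : ∀ k, 0 ≤ f k)
    (hlast : A 0 * f n ≤ (A 0 - if n = 1 then 0 else A 1) * f (n - 1)) :
    ∑ k ∈ Icc 1 n, A (n - k) * (f k - f (k - 1)) ≤ 0 := by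
  rw [sum_convolution_kernel_eq A f n hn]
  rcases eq_or_ne n 1 with rfl | h1
  · simp at hlast ⊢
    linarith
  · have hterm : ∀ k ∈ Icc 1 (n - 1), 0 ≤ (A (n - k - 1) - A (n - k)) * f k := by
      intro k hk
      rw [mem_Icc] at hk
      have h := hAmono (n - k - 1) (by omega)
      rw [show n - k - 1 + 1 = n - k by omega] at h
      exact mul_nonneg (by linarith) (hf k)
    have hs := single_le_sum hterm (show n - 1 ∈ Icc 1 (n - 1) by rw [mem_Icc]; omega)
    rw [show n - (n - 1) - 1 = 0 by omega, show n - (n - 1) = 1 by omega] at hs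
    rw [if_neg h1] at hlast
    have h0 := mul_nonneg (hApos (n - 1) (by omega)).le (hf 0)
    linarith

theorem mul_sq_le_of_div_le_div {a b θ : ℝ} (hb : b < a) (hb0 : 0 ≤ b) (hθ0 : 0 ≤ θ) (hθ1 : θ < 1)
    (h : θ / (a - b) ≤ (1 - θ) / a) : a * θ ^ 2 ≤ (a - b) * (1 - θ) ^ 2 := by
  have ha : 0 < a := by linarith
  rw [div_le_div_iff₀ (by linarith) ha] at h
  have hθ : θ ≤ 1 - θ := by
    by_contra! hlt
    nlinarith
  nlinarith [mul_le_mul_of_nonneg_left h hθ0,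
    mul_le_mul_of_nonneg_left hθ (mul_nonneg (sub_nonneg.2 hb.le) (sub_nonneg.2 hθ1.le))]

/-- Scalar weighted energy inequality for a nonincreasing convolution kernel. -/
theorem scalar_energy_le (n : ℕ) (hn : 1 ≤ n) (p A v : ℕ → ℝ) (θ : ℝ)
    (hp : 0 ≤ p n) (hpmono : ∀ k, k ≤ n - 1 → p (k + 1) ≤ p k)
    (hApos : ∀ k, k < n → 0 < A k)
    (hAmono : ∀ k, k + 1 < n → A (k + 1) ≤ A k)
    (hθ : A 0 * θ ^ 2 ≤ (A 0 - if n = 1 then 0 else A 1) * (1 - θ) ^ 2) :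
    A 0 * (p n * v n * v n)
      - (∑ k ∈ Icc 1 (n - 1), (A (n - k - 1) - A (n - k)) * (p k * v k * v k))
      - A (n - 1) * (p 0 * v 0 * v 0)
      ≤ 2 * (p n * ((1 - θ) * v n + θ * v (n - 1)) *
          ∑ k ∈ Icc 1 n, A (n - k) * (v k - v (k - 1))) := by
  set s := (1 - θ) * v n + θ * v (n - 1) with hs
  have hpn : ∀ k, k ≤ n → p n ≤ p k := by
    intro k hk
    induction hk using Nat.decreasingInduction with
    | self => exact le_rfl
    | of_succ k hk ih => exact ih.trans (hpmono k (by omega))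
  have hnonpos := sum_convolution_kernel_nonpos A (fun k => (v k - s) ^ 2) n hn hApos hAmono
    (fun k => sq_nonneg _) (by
      have h := mul_le_mul_of_nonneg_right hθ (sq_nonneg (v n - v (n - 1)))
      have e1 : (v n - s) ^ 2 = θ ^ 2 * (v n - v (n - 1)) ^ 2 := by rw [hs]; ring
      have e2 : (v (n - 1) - s) ^ 2 = (1 - θ) ^ 2 * (v n - v (n - 1)) ^ 2 := by rw [hs]; ring
      simp only [e1, e2]
      linarith)
  have hshift : ∑ k ∈ Icc 1 n, A (n - k) * ((v k - s) ^ 2 - (v (k - 1) - s) ^ 2)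
      = (∑ k ∈ Icc 1 n, A (n - k) * (v k ^ 2 - v (k - 1) ^ 2))
        - 2 * s * ∑ k ∈ Icc 1 n, A (n - k) * (v k - v (k - 1)) := by
    rw [mul_sum, ← sum_sub_distrib]
    exact sum_congr rfl fun k _ => by ring
  have habel := sum_convolution_kernel_eq A (fun k => v k ^ 2) n hn
  have hsum : p n * ∑ k ∈ Icc 1 (n - 1), (A (n - k - 1) - A (n - k)) * v k ^ 2
      ≤ ∑ k ∈ Icc 1 (n - 1), (A (n - k - 1) - A (n - k)) * (p k * v k * v k) := by
    rw [mul_sum]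
    refine sum_le_sum fun k hk => ?_
    rw [mem_Icc] at hk
    have h := hAmono (n - k - 1) (by omega)
    rw [show n - k - 1 + 1 = n - k by omega] at h
    have h2 := mul_le_mul_of_nonneg_left (hpn k (by omega))
      (mul_nonneg (sub_nonneg.2 h) (sq_nonneg (v k)))
    linarith
  have hzero := mul_le_mul_of_nonneg_left (hpn 0 (by omega))
    (mul_nonneg (hApos (n - 1) (by omega)).le (sq_nonneg (v 0)))
  have hmain := mul_nonpos_of_nonneg_of_nonpos hp hnonpos
  rw [hshift, habel] at hmain
  linarith

theorem mulVec_sum_mul_sub {ι κ : Type*} [Fintype κ] (S : Matrix ι κ ℝ)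
    (a : ℕ → ℝ) (u : ℕ → κ → ℝ) (t : Finset ℕ) (i : ι) :
    S.mulVec (fun j => ∑ k ∈ t, a k * (u k j - u (k - 1) j)) i
      = ∑ k ∈ t, a k * (S.mulVec (u k) i - S.mulVec (u (k - 1)) i) := by
  have h : (fun j => ∑ k ∈ t, a k * (u k j - u (k - 1) j))
      = ∑ k ∈ t, a k • (u k - u (k - 1)) := by
    ext j
    simp
  rw [h, Matrix.mulVec_sum]
  simp [Matrix.mulVec_smul, Matrix.mulVec_sub]

theorem dotProduct_transpose_mul_diagonal_mul_mulVec {ι κ : Type*} [Fintype ι] [DecidableEq ι]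
    [Fintype κ] (S : Matrix ι κ ℝ) (d : ι → ℝ) (x y : κ → ℝ) :
    x ⬝ᵥ (S.transpose * Matrix.diagonal d * S).mulVec y
      = ∑ i, d i * S.mulVec x i * S.mulVec y i := by
  rw [← Matrix.mulVec_mulVec, ← Matrix.mulVec_mulVec, Matrix.dotProduct_mulVec,
    Matrix.vecMul_transpose]
  simp only [dotProduct, Matrix.mulVec_diagonal]
  exact sum_congr rfl fun i _ => by ring

/-- Weighted energy inequality for a single factor `Sᵀ P⁽ⁿ⁾ S` of the stiffness matrix. -/
theorem matrix_energy_le {ι κ : Type*} [Fintype ι] [DecidableEq ι] [Fintype κ]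
    (n : ℕ) (hn : 1 ≤ n) (S : Matrix ι κ ℝ) (P : ℕ → ι → ℝ) (A : ℕ → ℝ) (θ : ℝ)
    (hP : ∀ i, 0 ≤ P n i) (hPmono : ∀ k, k ≤ n - 1 → ∀ i, P (k + 1) i ≤ P k i)
    (hApos : ∀ k, k < n → 0 < A k)
    (hAmono : ∀ k, k + 1 < n → A (k + 1) ≤ A k)
    (hθ : A 0 * θ ^ 2 ≤ (A 0 - if n = 1 then 0 else A 1) * (1 - θ) ^ 2)
    (u : ℕ → κ → ℝ) :
    A 0 * (∑ i, P n i * S.mulVec (u n) i * S.mulVec (u n) i)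
      - (∑ k ∈ Icc 1 (n - 1), (A (n - k - 1) - A (n - k)) *
          ∑ i, P k i * S.mulVec (u k) i * S.mulVec (u k) i)
      - A (n - 1) * (∑ i, P 0 i * S.mulVec (u 0) i * S.mulVec (u 0) i)
      ≤ 2 * ((fun i => (1 - θ) * u n i + θ * u (n - 1) i) ⬝ᵥ
          (S.transpose * Matrix.diagonal (P n) * S).mulVec
            (fun i => ∑ k ∈ Icc 1 n, A (n - k) * (u k i - u (k - 1) i))) := by
  have hx : ∀ i, S.mulVec (fun i => (1 - θ) * u n i + θ * u (n - 1) i) i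
      = (1 - θ) * S.mulVec (u n) i + θ * S.mulVec (u (n - 1)) i := by
    intro i
    have h : (fun i => (1 - θ) * u n i + θ * u (n - 1) i)
        = (1 - θ) • u n + θ • u (n - 1) := rfl
    rw [h, Matrix.mulVec_add, Matrix.mulVec_smul, Matrix.mulVec_smul]
    rfl
  rw [dotProduct_transpose_mul_diagonal_mul_mulVec]
  simp only [hx, mulVec_sum_mul_sub S (fun k => A (n - k)) u, mul_sum (s := Finset.univ)]
  rw [sum_comm, ← sum_sub_distrib, ← sum_sub_distrib]
  exact sum_le_sum fun i _ => scalar_energy_le n hn (fun k => P k i) A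
    (fun k => S.mulVec (u k) i) θ (hP i) (fun k hk => hPmono k hk i) hApos hAmono hθ

/-- inequality (2.7)/(uADu) of the paper.
For arbitrary matrices `S₁, S₂`, time-nonincreasing positive diagonal weights
`P₁^{(k)}, P₂^{(k)}`, non-increasing positive kernels `A 0 ≥ ⋯ ≥ A (n−1) > 0` (convention
`A 1 := 0` for `n = 1`) and `θ ∈ [0,1)` with `θ/(A 0 − A 1) ≤ (1−θ)/A 0`, the stiffness
matrix `A = S₁ᵀP₁^{(n)}S₁ + S₂ᵀP₂^{(n)}S₂` satisfies the energy inequality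
`2 (u^{n−θ})ᵀ A w ≥ A₀[...] − ∑_{k=1}^{n−1}(A_{n−k−1}−A_{n−k})[...] − A_{n−1}[...]`,
where `w = ∑_{k=1}^n A_{n−k}(u^k − u^{k−1})`. -/
theorem stmt9 (m m1 m2 n : ℕ) (hm : 1 ≤ m) (hm1 : 1 ≤ m1) (hm2 : 1 ≤ m2) (hn : 1 ≤ n)
    (S1 : Matrix (Fin m1) (Fin m) ℝ) (S2 : Matrix (Fin m2) (Fin m) ℝ)
    (P1 : ℕ → Fin m1 → ℝ) (P2 : ℕ → Fin m2 → ℝ)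
    (hP1pos : ∀ k, k ≤ n → ∀ i, 0 < P1 k i)
    (hP2pos : ∀ k, k ≤ n → ∀ i, 0 < P2 k i)
    (hP1mono : ∀ k, k ≤ n - 1 → ∀ i, P1 (k + 1) i ≤ P1 k i)
    (hP2mono : ∀ k, k ≤ n - 1 → ∀ i, P2 (k + 1) i ≤ P2 k i)
    (A : ℕ → ℝ)
    (hApos : ∀ k, k < n → 0 < A k)
    (hAmono : ∀ k, k + 1 < n → A (k + 1) ≤ A k)
    (θ : ℝ) (hθ0 : 0 ≤ θ) (hθ1 : θ < 1)
    (A1 : ℝ) (hA1 : A1 = if n = 1 then 0 else A 1)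
    (hA1lt : A1 < A 0)
    (hθA : θ / (A 0 - A1) ≤ (1 - θ) / A 0)
    (u : ℕ → Fin m → ℝ) :
    A 0 * ((∑ i, P1 n i * S1.mulVec (u n) i * S1.mulVec (u n) i)
            + ∑ i, P2 n i * S2.mulVec (u n) i * S2.mulVec (u n) i)
      - (∑ k ∈ Icc 1 (n - 1), (A (n - k - 1) - A (n - k)) *
          ((∑ i, P1 k i * S1.mulVec (u k) i * S1.mulVec (u k) i)
            + ∑ i, P2 k i * S2.mulVec (u k) i * S2.mulVec (u k) i))
      - A (n - 1) * ((∑ i, P1 0 i * S1.mulVec (u 0) i * S1.mulVec (u 0) i)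
            + ∑ i, P2 0 i * S2.mulVec (u 0) i * S2.mulVec (u 0) i)
      ≤ 2 * ((fun i => (1 - θ) * u n i + θ * u (n - 1) i) ⬝ᵥ
          (S1.transpose * Matrix.diagonal (P1 n) * S1
            + S2.transpose * Matrix.diagonal (P2 n) * S2).mulVec
            (fun i => ∑ k ∈ Icc 1 n, A (n - k) * (u k i - u (k - 1) i))) := by
  have hθ : A 0 * θ ^ 2 ≤ (A 0 - if n = 1 then 0 else A 1) * (1 - θ) ^ 2 := by
    rw [← hA1]
    refine mul_sq_le_of_div_le_div hA1lt ?_ hθ0 hθ1 hθA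
    rw [hA1]
    split_ifs with h
    · exact le_rfl
    · exact (hApos 1 (by omega)).le
  have h1 := matrix_energy_le n hn S1 P1 A θ (fun i => (hP1pos n le_rfl i).le) hP1mono
    hApos hAmono hθ u
  have h2 := matrix_energy_le n hn S2 P2 A θ (fun i => (hP2pos n le_rfl i).le) hP2mono
    hApos hAmono hθ u
  simp only [Matrix.add_mulVec, dotProduct_add, mul_add, sum_add_distrib]
  linarith
end
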